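/- Let X be a random vector in ℝ^d with a pdf f_X, and let q be a quantizer with quantization regions S_i, reconstruction values x̂_i, and p_i = P(X ∈ S_i), satisfying E[‖X − q(X)‖^r] ≤ D. Assume that for each i with p_i > 0 the conditional differential entropy h_i = −∫_{S_i} (f_X(x)/p_i) log(f_X(x)/p_i) dx is well-defined and finite, and set h(X | q(X)) = ∑_i p_i h_i. Then for every ε > 0 and δ > 0: h(X | q(X)) ≤ ∑_i p_i log( Λ_{i,ε} + d·V_d·D^{d/r}·Γ(d/r, ε^r/(Dδ)) ) + | log( r / δ^{d/r} ) | · D/ε^r + 1/δ, where Λ_{i,ε} is the Lebesgue measure of B_{i,ε} = { x ∈ S_i : ‖x − x̂_i‖ ≤ ε }. -/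

import Mathlib

open MeasureTheory Filter Set
open scoped ENNReal Topology ProbabilityTheory Pointwise

noncomputable section

/-- `N` is a norm on `ℝ^d`. -/
structure IsNorm {d : ℕ} (N : (Fin d → ℝ) → ℝ) : Prop where
  nonneg : ∀ x, 0 ≤ N x
  eq_zero_iff : ∀ x, N x = 0 ↔ x = 0
  smul : ∀ (c : ℝ) (x : Fin d → ℝ), N (c • x) = |c| * N x
  triangle : ∀ x y, N (x + y) ≤ N x + N y

/-- Lebesgue volume `V_d` of the unit ball of the norm `N`. -/
def unitBallVol {d : ℕ} (N : (Fin d → ℝ) → ℝ) : ℝ :=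
  (volume {x : Fin d → ℝ | N x ≤ 1}).toReal

/-- A (symbol-wise) quantizer: countably many disjoint Borel quantization regions `S i`
covering the space, with reconstruction values `c i`. -/
structure Quantizer (E : Type*) [MeasurableSpace E] where
  S : ℤ → Set E
  c : ℤ → E
  meas : ∀ i, MeasurableSet (S i)
  disj : Pairwise (Function.onFun Disjoint S)
  cover : ⋃ i, S i = Set.univ

/-- Expected `r`-th power distortion `E[‖X - q(X)‖^r]` of a quantizer, for a source with law `μ`
and norm `N`. -/
def Quantizer.distortion {E : Type*} [MeasurableSpace E] [Sub E] (q : Quantizer E)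
    (μ : Measure E) (N : E → ℝ) (r : ℝ) : ℝ≥0∞ :=
  ∑' i, ∫⁻ x in q.S i, ENNReal.ofReal (N (x - q.c i) ^ r) ∂μ

/-- Output entropy `H(q(X)) = -∑ pᵢ log pᵢ` of a quantizer (as an extended nonneg. real). -/
def Quantizer.entropy {E : Type*} [MeasurableSpace E] (q : Quantizer E) (μ : Measure E) : ℝ≥0∞ :=
  ∑' i, ENNReal.ofReal (Real.negMulLog (μ (q.S i)).toReal)

/-- Output entropy `H(q(X)) = -∑ pᵢ log pᵢ` of a quantizer (as a real number). -/
def Quantizer.entropyR {E : Type*} [MeasurableSpace E] (q : Quantizer E) (μ : Measure E) : ℝ :=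
  ∑' i, Real.negMulLog (μ (q.S i)).toReal

open scoped Classical in
/-- Kullback-Leibler divergence between two measures. -/
def klDiv {α : Type*} [MeasurableSpace α] (μ ν : Measure α) : ℝ≥0∞ :=
  if μ ≪ ν ∧ Integrable (fun x => Real.log (μ.rnDeriv ν x).toReal) μ
  then ENNReal.ofReal (∫ x, Real.log (μ.rnDeriv ν x).toReal ∂μ)
  else ⊤

/-- Mutual information of a joint law `π`, i.e. the KL divergence of `π` from the product of
its marginals. -/
def mutualInfo {α β : Type*} [MeasurableSpace α] [MeasurableSpace β]
    (π : Measure (α × β)) : ℝ≥0∞ :=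
  klDiv π ((π.map Prod.fst).prod (π.map Prod.snd))

/-- The rate-distortion function `R(D)`: the infimum of the mutual information `I(X; X̂)` over
all Markov kernels `P_{X̂|X}` with expected `r`-th power distortion at most `D`. -/
def RDfun {E : Type*} [MeasurableSpace E] [Sub E] (μ : Measure E) (N : E → ℝ) (r D : ℝ) :
    ℝ≥0∞ :=
  ⨅ (κ : ProbabilityTheory.Kernel E E) (_ : ProbabilityTheory.IsMarkovKernel κ)
    (_ : ∫⁻ p, ENNReal.ofReal (N (p.1 - p.2) ^ r) ∂(μ.compProd κ) ≤ ENNReal.ofReal D),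
    mutualInfo (μ.compProd κ)

/-- The smallest output entropy `R_{r,d}(D)` of a quantizer with `r`-th power distortion
at most `D`. -/
def RQfun {E : Type*} [MeasurableSpace E] [Sub E] (μ : Measure E) (N : E → ℝ) (r D : ℝ) :
    ℝ≥0∞ :=
  ⨅ (q : Quantizer E) (_ : q.distortion μ N r ≤ ENNReal.ofReal D), q.entropy μ

/-- The asymptotic excess rate `ℛ = liminf_{D ↓ 0} (R_{r,d}(D) - R(D))`. -/
def excessRate {E : Type*} [MeasurableSpace E] [Sub E] (μ : Measure E) (N : E → ℝ) (r : ℝ) :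
    ℝ :=
  Filter.liminf (fun D => (RQfun μ N r D).toReal - (RDfun μ N r D).toReal) (𝓝[>] (0:ℝ))

/-- The upper incomplete Gamma function `Γ(s, a) = ∫_a^∞ ξ^(s-1) e^(-ξ) dξ`. -/
def uGamma (s a : ℝ) : ℝ := ∫ ξ in Set.Ioi a, ξ ^ (s - 1) * Real.exp (-ξ)

/-- The part of the quantization cell `S i` within distance `ε` of the reconstruction point. -/
def Bcell {E : Type*} [MeasurableSpace E] [Sub E] (q : Quantizer E) (N : E → ℝ) (ε : ℝ)
    (i : ℤ) : Set E :=
  {x | x ∈ q.S i ∧ N (x - q.c i) ≤ ε}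


theorem exists_linearEquiv_norm_eq {E : Type} [AddCommGroup E] [Module ℝ E] (N : E → ℝ)
    (h0 : ∀ x, N x = 0 ↔ x = 0) (hsmul : ∀ (c : ℝ) x, N (c • x) = |c| * N x)
    (hadd : ∀ x y, N (x + y) ≤ N x + N y) :
    ∃ (F : Type) (_ : NormedAddCommGroup F) (_ : NormedSpace ℝ F)
      (φ : E ≃ₗ[ℝ] F), ∀ x, ‖φ x‖ = N x := by
  let p : AddGroupNorm E :=
    ⟨⟨N, (h0 0).2 rfl, hadd, fun x => by simpa using hsmul (-1) x⟩, fun x hx => (h0 x).1 hx⟩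
  let inst : NormedAddCommGroup E := AddGroupNorm.toNormedAddCommGroup p
  let inst' : NormedSpace ℝ E := { norm_smul_le := fun c x => (hsmul c x).le }
  exact ⟨E, inst, inst', LinearEquiv.refl ℝ E, fun x => rfl⟩

theorem IsNorm.exists_linearEquiv {d : ℕ} {N : (Fin d → ℝ) → ℝ} (hN : IsNorm N) :
    ∃ (F : Type) (_ : NormedAddCommGroup F) (_ : NormedSpace ℝ F)
      (φ : (Fin d → ℝ) ≃ₗ[ℝ] F), ∀ x, ‖φ x‖ = N x :=
  exists_linearEquiv_norm_eq N hN.eq_zero_iff hN.smul hN.triangle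

theorem IsNorm.continuous {d : ℕ} {N : (Fin d → ℝ) → ℝ} (hN : IsNorm N) : Continuous N := by
  obtain ⟨F, _, _, φ, hφ⟩ := hN.exists_linearEquiv
  have : Continuous φ := φ.toLinearMap.continuous_of_finiteDimensional
  rw [← funext hφ]
  exact this.norm

theorem IsNorm.volume_le_lt_top {d : ℕ} {N : (Fin d → ℝ) → ℝ} (hN : IsNorm N) (s : ℝ) :
    volume {x | N x ≤ s} < ∞ := by
  obtain ⟨F, _, _, φ, hφ⟩ := hN.exists_linearEquiv
  have : FiniteDimensional ℝ F := φ.finiteDimensional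
  have : ProperSpace F := FiniteDimensional.proper ℝ F
  have hset : {x | N x ≤ s} = φ.symm '' Metric.closedBall 0 s := by
    ext x
    rw [LinearEquiv.image_symm_eq_preimage]
    simp [hφ]
  rw [hset]
  exact ((isCompact_closedBall (0 : F) s).image
    φ.symm.toLinearMap.continuous_of_finiteDimensional).measure_lt_top

theorem volume_setOf_sub_le {d : ℕ} (N : (Fin d → ℝ) → ℝ) (c : Fin d → ℝ) (s : ℝ) :
    volume {x | N (x - c) ≤ s} = volume {x | N x ≤ s} := by
  simp only [sub_eq_add_neg]
  exact measure_preimage_add_right volume (-c) {x | N x ≤ s}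

theorem IsNorm.unitBallVol_pos {d : ℕ} {N : (Fin d → ℝ) → ℝ} (hN : IsNorm N) :
    0 < unitBallVol N := by
  refine ENNReal.toReal_pos (ne_of_gt ?_) (hN.volume_le_lt_top 1).ne
  have ho : IsOpen {x | N x < 1} := isOpen_lt hN.continuous continuous_const
  refine (ho.measure_pos volume ⟨0, ?_⟩).trans_le (measure_mono fun x (hx : N x < 1) => show N x ≤ 1 from hx.le)
  simp [(hN.eq_zero_iff 0).2 rfl]

/-- Integration of radial functions in polar coordinates. -/
theorem IsNorm.integral_radial {d : ℕ} (hd : 0 < d) {N : (Fin d → ℝ) → ℝ} (hN : IsNorm N)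
    (G : ℝ → ℝ) :
    (IntegrableOn (fun y => y ^ (d - 1) * G y) (Ioi 0) → Integrable fun x => G (N x)) ∧
      ∫ x, G (N x) = d * unitBallVol N * ∫ y in Ioi (0 : ℝ), y ^ (d - 1) * G y := by
  obtain ⟨F, _, _, φ, hφ⟩ := hN.exists_linearEquiv
  have : FiniteDimensional ℝ F := φ.finiteDimensional
  have hdim : Module.finrank ℝ F = d := by rw [← φ.finrank_eq]; simp
  have : Nontrivial F := Module.nontrivial_of_finrank_pos (R := ℝ) (by omega)
  borelize F
  let ψ := φ.toContinuousLinearEquiv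
  let e := ψ.toHomeomorph.toMeasurableEquiv
  let ν : Measure F := volume.map ψ
  have : ν.IsAddHaarMeasure := ψ.isAddHaarMeasure_map volume
  have hmp : MeasurePreserving e volume ν := ⟨e.measurable, rfl⟩
  have he : ∀ x, ‖e x‖ = N x := hφ
  have hball : ν.real (Metric.ball 0 1) = unitBallVol N := by
    rw [measureReal_def, ← Measure.addHaar_closedBall_eq_addHaar_ball,
      ← hmp.measure_preimage_equiv]
    simp only [unitBallVol, preimage, Metric.mem_closedBall, dist_zero_right, he]
  constructor
  · intro hG
    have h1 : Integrable (fun y : F => G ‖y‖) ν := by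
      rw [integrable_fun_norm_addHaar, hdim]
      simpa using hG
    have h2 := (hmp.integrable_comp_emb e.measurableEmbedding).2 h1
    simpa only [Function.comp_def, he] using h2
  · have h1 := hmp.integral_comp' (fun y : F => G ‖y‖)
    simp only [he] at h1
    rw [h1, integral_fun_norm_addHaar, hdim, hball]
    simp [mul_assoc]

/-- The function `exp (-y ^ r / a)` cut off to `y > ε`. -/
def expTail (r a ε y : ℝ) : ℝ := (Ioi ε).indicator (fun y => Real.exp (-(y ^ r / a))) y

theorem expTail_nonneg (r a ε y : ℝ) : 0 ≤ expTail r a ε y :=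
  indicator_nonneg (fun _ _ => (Real.exp_pos _).le) _

theorem integrableOn_pow_mul_expTail {d : ℕ} {r a ε : ℝ} (hr : 0 < r) (ha : 0 < a) :
    IntegrableOn (fun y => y ^ (d - 1) * expTail r a ε y) (Ioi 0) := by
  have h := integrableOn_rpow_mul_exp_neg_mul_rpow (p := r) (s := ((d - 1 : ℕ) : ℝ)) (b := a⁻¹)
    (by linarith [Nat.cast_nonneg (α := ℝ) (d - 1)]) hr (by positivity)
  refine (Integrable.indicator h (measurableSet_Ioi (a := ε))).congr ?_
  refine Eventually.of_forall fun y => ?_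
  by_cases hy : y ∈ Ioi ε
  · simp [expTail, hy, Real.rpow_natCast]; left; ring
  · simp [expTail, hy]

theorem integral_pow_mul_expTail {d : ℕ} (hd : 0 < d) {r a ε : ℝ} (hr : 0 < r) (ha : 0 < a)
    (hε : 0 < ε) :
    ∫ y in Ioi (0 : ℝ), y ^ (d - 1) * expTail r a ε y
      = a ^ ((d : ℝ) / r) / r * uGamma ((d : ℝ) / r) (ε ^ r / a) := by
  set s := (d : ℝ) / r with hs
  let G : ℝ → ℝ := fun ξ => ξ ^ (s - 1) * Real.exp (-ξ)
  have h1 : ∫ y in Ioi (0 : ℝ), y ^ (d - 1) * expTail r a ε y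
      = ∫ y in Ioi ε, y ^ (d - 1) * Real.exp (-(y ^ r / a)) := by
    have : (fun y => y ^ (d - 1) * expTail r a ε y)
        = (Ioi ε).indicator fun y => y ^ (d - 1) * Real.exp (-(y ^ r / a)) := by
      funext y
      by_cases hy : y ∈ Ioi ε <;> simp [expTail, hy]
    rw [this, setIntegral_indicator measurableSet_Ioi,
      inter_eq_self_of_subset_right (Ioi_subset_Ioi hε.le)]
  have h2 := integral_comp_rpow_Ioi_of_pos' (g := fun ξ => G (a⁻¹ * ξ)) hr
    (Real.rpow_nonneg hε.le r)
  rw [Real.rpow_rpow_inv hε.le hr.ne', integral_comp_mul_left_Ioi G _ (inv_pos.2 ha)] at h2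
  have h3 : ∫ y in Ioi ε, (r * y ^ (r - 1)) • G (a⁻¹ * y ^ r)
      = (r * a ^ (1 - s)) * ∫ y in Ioi ε, y ^ (d - 1) * Real.exp (-(y ^ r / a)) := by
    rw [← integral_const_mul]
    refine setIntegral_congr_fun measurableSet_Ioi fun y hy => ?_
    have hy0 : 0 < y := hε.trans hy
    have e1 : (a⁻¹ * y ^ r) ^ (s - 1) = a ^ (1 - s) * y ^ (d - r) := by
      rw [Real.mul_rpow (by positivity) (by positivity), Real.inv_rpow ha.le,
        ← Real.rpow_neg ha.le, ← Real.rpow_mul hy0.le]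
      congr 2
      · ring
      · rw [hs]; field_simp
    have e2 : y ^ (d - 1) = y ^ (r - 1) * y ^ (d - r) := by
      rw [← Real.rpow_add hy0, ← Real.rpow_natCast, Nat.cast_sub hd]
      congr 1
      push_cast
      ring
    simp only [G, smul_eq_mul, e1, e2]
    rw [show a⁻¹ * y ^ r = y ^ r / a by ring]
    ring
  rw [h1]
  rw [h3, show a⁻¹ * ε ^ r = ε ^ r / a by ring, inv_inv, smul_eq_mul] at h2
  have hu : ∫ x in Ioi (ε ^ r / a), G x = uGamma s (ε ^ r / a) := rfl
  rw [hu, Real.rpow_sub ha, Real.rpow_one] at h2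
  have : 0 < a ^ s := Real.rpow_pos_of_pos ha s
  field_simp at h2 ⊢
  linarith

theorem uGamma_pos {s a : ℝ} (hs : 0 < s) (ha : 0 < a) : 0 < uGamma s a := by
  have hint : IntegrableOn (fun ξ : ℝ => ξ ^ (s - 1) * Real.exp (-ξ)) (Ioi a) := by
    have := (Real.GammaIntegral_convergent hs).mono_set (Ioi_subset_Ioi ha.le)
    simpa only [mul_comm] using this
  have hpos : ∀ ξ ∈ Ioi a, 0 < ξ ^ (s - 1) * Real.exp (-ξ) := fun ξ hξ =>
    mul_pos (Real.rpow_pos_of_pos (ha.trans hξ) _) (Real.exp_pos _)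
  rw [uGamma, setIntegral_pos_iff_support_of_nonneg_ae _ hint]
  · rw [inter_eq_self_of_subset_right fun ξ hξ => Function.mem_support.2 (hpos ξ hξ).ne']
    simp
  · exact (ae_restrict_mem measurableSet_Ioi).mono fun ξ hξ => (hpos ξ hξ).le

/-- Gibbs' variational bound on the differential entropy of a density `F`. -/
theorem neg_integral_mul_log_le {E : Type*} [MeasurableSpace E] {ν : Measure E}
    {F W g : E → ℝ} (hF0 : ∀ x, 0 ≤ F x) (hF1 : ∫ x, F x ∂ν = 1)
    (hF : Integrable (fun x => F x * Real.log (F x)) ν)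
    (hFW : Integrable (fun x => F x * W x) ν) (hg : Integrable g ν) (hg0 : ∀ x, 0 < g x)
    (hgW : ∀ x, -Real.log (g x) ≤ W x) {Z : ℝ} (hZ : 0 < Z) (hgZ : ∫ x, g x ∂ν ≤ Z) :
    -∫ x, F x * Real.log (F x) ∂ν ≤ (∫ x, F x * W x ∂ν) + Real.log Z := by
  have hFi : Integrable F ν := integrable_of_integral_eq_one hF1
  have key : ∀ x, F x - g x * Z⁻¹
      ≤ F x * Real.log (F x) + F x * W x + F x * Real.log Z := by
    intro x
    have hgx := hg0 x
    rcases (hF0 x).eq_or_lt with h0 | h0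
    · rw [← h0]; simp only [zero_mul, add_zero, zero_sub, neg_nonpos]; positivity
    · have h1 := Real.one_sub_inv_le_log_of_pos (x := F x * Z / g x) (by positivity)
      rw [Real.log_div (by positivity) hgx.ne', Real.log_mul h0.ne' hZ.ne'] at h1
      have h2 : F x * (1 - (F x * Z / g x)⁻¹) = F x - g x * Z⁻¹ := by field_simp
      rw [← h2]
      have := hgW x
      calc _ ≤ F x * (Real.log (F x) + W x + Real.log Z) :=
            mul_le_mul_of_nonneg_left (by linarith) h0.le
        _ = _ := by ring
  have hI := integral_mono (hFi.sub (hg.mul_const _))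
    ((hF.add hFW).add (hFi.mul_const (Real.log Z))) key
  rw [integral_sub' hFi (hg.mul_const _), integral_add' (hF.add hFW) (hFi.mul_const _),
    integral_add' hF hFW, integral_mul_const, integral_mul_const, hF1] at hI
  have : (∫ x, g x ∂ν) * Z⁻¹ ≤ 1 := by
    rw [← div_eq_mul_inv]; exact (div_le_one hZ).2 hgZ
  linarith

/-- The unnormalised reference density: `1` on the ball of radius `ε` and `k * exp (-y ^ r / a)`
outside, as a function of the distance `y` to the centre. -/
def refDensity (r a ε k y : ℝ) : ℝ := (Iic ε).indicator 1 y + k * expTail r a ε y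

theorem refDensity_pos {r a ε k : ℝ} (hk : 0 < k) (y : ℝ) : 0 < refDensity r a ε k y := by
  rcases le_or_gt y ε with hy | hy
  · simp [refDensity, expTail, hy, hy.not_gt]
  · simp only [refDensity, expTail, mem_Iic, hy.not_ge, not_false_eq_true, indicator_of_notMem,
      mem_Ioi, hy, indicator_of_mem, zero_add]
    positivity

theorem neg_log_refDensity_le {r a ε k : ℝ} (hr : 0 < r) (ha : 0 < a) (hε : 0 < ε) (hk : 0 < k)
    {y : ℝ} (hy0 : 0 ≤ y) :
    -Real.log (refDensity r a ε k y) ≤ (|Real.log k| / ε ^ r + 1 / a) * y ^ r := by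
  have hyr : 0 ≤ y ^ r := Real.rpow_nonneg hy0 r
  have hεr : 0 < ε ^ r := Real.rpow_pos_of_pos hε r
  rcases le_or_gt y ε with hy | hy
  · simp only [refDensity, expTail, mem_Iic, hy, indicator_of_mem, Pi.one_apply, mem_Ioi,
      hy.not_gt, not_false_eq_true, indicator_of_notMem, mul_zero, add_zero, Real.log_one,
      neg_zero]
    positivity
  · simp only [refDensity, expTail, mem_Iic, hy.not_ge, not_false_eq_true, indicator_of_notMem,
      mem_Ioi, hy, indicator_of_mem, zero_add]
    rw [Real.log_mul hk.ne' (Real.exp_ne_zero _), Real.log_exp]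
    have h1 : |Real.log k| ≤ |Real.log k| / ε ^ r * y ^ r := by
      rw [div_mul_eq_mul_div, le_div_iff₀ hεr]
      exact mul_le_mul_of_nonneg_left (Real.rpow_le_rpow hε.le hy.le hr.le) (abs_nonneg _)
    have h2 := neg_abs_le (Real.log k)
    have h3 : (|Real.log k| / ε ^ r + 1 / a) * y ^ r
        = |Real.log k| / ε ^ r * y ^ r + y ^ r / a := by ring
    rw [h3]
    linarith

theorem integrable_refDensity {d : ℕ} (hd : 0 < d) {r a ε k : ℝ} (hr : 0 < r) (ha : 0 < a)
    (hε : 0 < ε) (hk : 0 < k) {N : (Fin d → ℝ) → ℝ} (hN : IsNorm N) (c : Fin d → ℝ)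
    (S : Set (Fin d → ℝ)) :
    IntegrableOn (fun x => refDensity r a ε k (N (x - c))) S ∧
      ∫ x in S, refDensity r a ε k (N (x - c))
        ≤ volume.real {x | x ∈ S ∧ N (x - c) ≤ ε}
          + d * unitBallVol N * (k * a ^ ((d : ℝ) / r) / r)
            * uGamma ((d : ℝ) / r) (ε ^ r / a) := by
  have hNm : Measurable fun x => N (x - c) :=
    (hN.continuous.comp (continuous_id.sub continuous_const)).measurable
  have hB : MeasurableSet {x | N (x - c) ≤ ε} := measurableSet_le hNm measurable_const
  have hBfin : volume {x | N (x - c) ≤ ε} < ∞ := by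
    rw [volume_setOf_sub_le]; exact hN.volume_le_lt_top ε
  obtain ⟨hrad, hradI⟩ := hN.integral_radial hd (expTail r a ε)
  have ht : Integrable fun x => expTail r a ε (N (x - c)) :=
    (hrad (integrableOn_pow_mul_expTail hr ha)).comp_sub_right c
  have hb : Integrable ({x | N (x - c) ≤ ε}.indicator (1 : (Fin d → ℝ) → ℝ)) :=
    (integrable_indicator_iff hB).2 (integrableOn_const hBfin.ne)
  have heq : (fun x => refDensity r a ε k (N (x - c)))
      = fun x => {x | N (x - c) ≤ ε}.indicator (1 : (Fin d → ℝ) → ℝ) x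
        + k * expTail r a ε (N (x - c)) := by
    funext x
    simp [refDensity, indicator]
  rw [heq]
  refine ⟨(hb.add (ht.const_mul k)).integrableOn, ?_⟩
  rw [integral_add hb.integrableOn (ht.const_mul k).integrableOn, integral_const_mul,
    setIntegral_indicator hB]
  refine add_le_add (le_of_eq ?_) ?_
  · simp only [Pi.one_apply, integral_const, smul_eq_mul, mul_one, measureReal_restrict_apply_univ]
    rfl
  · have h1 : ∫ x in S, expTail r a ε (N (x - c)) ≤ ∫ x, expTail r a ε (N (x - c)) :=
      setIntegral_le_integral ht (Eventually.of_forall fun x => expTail_nonneg _ _ _ _)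
    rw [integral_sub_right_eq_self (μ := volume) (fun x => expTail r a ε (N x)) c, hradI,
      integral_pow_mul_expTail hd hr ha hε] at h1
    calc _ ≤ k * _ := mul_le_mul_of_nonneg_left h1 hk.le
      _ = _ := by ring

theorem Quantizer.hasSum_measure {E : Type*} [MeasurableSpace E] (q : Quantizer E)
    (μ : Measure E) [IsProbabilityMeasure μ] : HasSum (fun i => (μ (q.S i)).toReal) 1 := by
  have h := measure_iUnion q.disj q.meas (μ := μ)
  rw [q.cover, measure_univ] at h
  have hsum := ENNReal.hasSum_toReal (f := fun i => μ (q.S i)) (by rw [← h]; simp)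
  rwa [← ENNReal.tsum_toReal_eq fun i => measure_ne_top μ _, ← h, ENNReal.toReal_one] at hsum

/-- Eq. (45): variational upper bound on the conditional differential
entropy `h(X | q(X))`. -/
theorem cond_entropy_upper_bound {d : ℕ} (hd : 0 < d) {r : ℝ} (hr : 0 < r)
    {N : (Fin d → ℝ) → ℝ} (hN : IsNorm N)
    (μ : Measure (Fin d → ℝ)) [IsProbabilityMeasure μ]
    (f : (Fin d → ℝ) → ℝ) (hfm : Measurable f) (hf0 : ∀ x, 0 ≤ f x)
    (hμf : μ = volume.withDensity fun x => ENNReal.ofReal (f x))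
    (q : Quantizer (Fin d → ℝ)) (D ε δ : ℝ) (hD : 0 < D) (hε : 0 < ε) (hδ : 0 < δ)
    (hdist : q.distortion μ N r ≤ ENNReal.ofReal D)
    (h : ℤ → ℝ)
    (hwd : ∀ i, (μ (q.S i)).toReal ≠ 0 →
      IntegrableOn
        (fun x => f x / (μ (q.S i)).toReal * Real.log (f x / (μ (q.S i)).toReal))
        (q.S i) volume ∧
      h i = -∫ x in q.S i,
        f x / (μ (q.S i)).toReal * Real.log (f x / (μ (q.S i)).toReal))
    (hz : ∀ i, (μ (q.S i)).toReal = 0 → h i = 0)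
    (hsum : Summable fun i => (μ (q.S i)).toReal * h i) :
    ∑' i : ℤ, (μ (q.S i)).toReal * h i
      ≤ (∑' i : ℤ, (μ (q.S i)).toReal *
            Real.log ((volume (Bcell q N ε i)).toReal
              + d * unitBallVol N * D ^ ((d : ℝ) / r) * uGamma ((d : ℝ) / r) (ε ^ r / (D * δ))))
        + |Real.log (r / δ ^ ((d : ℝ) / r))| * (D / ε ^ r) + 1 / δ := by
  set k := r / δ ^ ((d : ℝ) / r) with hk_def
  have hδr : 0 < δ ^ ((d : ℝ) / r) := Real.rpow_pos_of_pos hδ _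
  have hk : 0 < k := div_pos hr hδr
  have ha : 0 < D * δ := mul_pos hD hδ
  have hεr : 0 < ε ^ r := Real.rpow_pos_of_pos hε r
  have hdr : (0 : ℝ) < (d : ℝ) / r := by positivity
  set C := d * unitBallVol N * D ^ ((d : ℝ) / r) * uGamma ((d : ℝ) / r) (ε ^ r / (D * δ)) with hC
  have hC0 : 0 < C := by
    have := hN.unitBallVol_pos
    have := uGamma_pos hdr (div_pos hεr ha)
    have : 0 < D ^ ((d : ℝ) / r) := Real.rpow_pos_of_pos hD _
    positivity
  have hkC : d * unitBallVol N * (k * (D * δ) ^ ((d : ℝ) / r) / r)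
      * uGamma ((d : ℝ) / r) (ε ^ r / (D * δ)) = C := by
    rw [hC, hk_def, Real.mul_rpow hD.le hδ.le]
    field_simp
  set K := |Real.log k| / ε ^ r + 1 / (D * δ) with hK
  have hK0 : 0 ≤ K := by positivity
  let e : ℤ → ℝ≥0∞ := fun i => ∫⁻ x in q.S i, ENNReal.ofReal (N (x - q.c i) ^ r) ∂μ
  have he_tsum : ∑' i, e i ≤ ENNReal.ofReal D := hdist
  have he_top : ∑' i, e i ≠ ∞ := ne_top_of_le_ne_top ENNReal.ofReal_ne_top he_tsum
  have he_sum : HasSum (fun i => (e i).toReal) (∑' i, e i).toReal := by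
    have := ENNReal.hasSum_toReal he_top
    rwa [← ENNReal.tsum_toReal_eq fun i => ENNReal.ne_top_of_tsum_ne_top he_top i] at this
  have he_le : (∑' i, e i).toReal ≤ D := ENNReal.toReal_le_of_le_ofReal hD.le he_tsum
  have hp := q.hasSum_measure μ
  have hcell : ∀ i, (μ (q.S i)).toReal * h i
      ≤ (μ (q.S i)).toReal * Real.log ((volume (Bcell q N ε i)).toReal + C)
        + K * (e i).toReal := by
    intro i
    by_cases hpi : (μ (q.S i)).toReal = 0
    · rw [hpi, zero_mul, zero_mul, zero_add]
      positivity
    obtain ⟨hint, hhi⟩ := hwd i hpi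
    have hfm' : Measurable fun x => ENNReal.ofReal (f x) := hfm.ennreal_ofReal
    have hNm : Measurable fun x => N (x - q.c i) ^ r :=
      (hN.continuous.comp (continuous_id.sub continuous_const)).measurable.pow_const r
    have hN0 : ∀ x, 0 ≤ N (x - q.c i) ^ r := fun x => Real.rpow_nonneg (hN.nonneg _) r
    have hp0 : 0 < (μ (q.S i)).toReal := lt_of_le_of_ne ENNReal.toReal_nonneg (Ne.symm hpi)
    set p := (μ (q.S i)).toReal with hp_def
    have hswap : ∀ G : (Fin d → ℝ) → ℝ, ∫ x in q.S i, G x ∂μ = ∫ x in q.S i, f x * G x := by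
      intro G
      rw [hμf, setIntegral_withDensity_eq_setIntegral_toReal_smul hfm' (by simp) G (q.meas i)]
      simp only [ENNReal.toReal_ofReal (hf0 _), smul_eq_mul]
    have hF1 : ∫ x in q.S i, f x / p = 1 := by
      have := hswap fun _ => 1
      rw [integral_const] at this
      simp only [mul_one, smul_eq_mul, measureReal_def, Measure.restrict_apply_univ] at this
      rw [integral_div, ← this, div_self hpi]
    have heI : ∫ x in q.S i, f x * N (x - q.c i) ^ r = (e i).toReal := by
      rw [← hswap, integral_eq_lintegral_of_nonneg_ae (Eventually.of_forall hN0)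
        hNm.aestronglyMeasurable]
    have hNi : IntegrableOn (fun x => N (x - q.c i) ^ r) (q.S i) μ := by
      refine ⟨hNm.aestronglyMeasurable, ?_⟩
      rw [hasFiniteIntegral_iff_ofReal (Eventually.of_forall hN0)]
      exact (ENNReal.ne_top_of_tsum_ne_top he_top i).lt_top
    have hfN : IntegrableOn (fun x => f x * N (x - q.c i) ^ r) (q.S i) := by
      rw [IntegrableOn, hμf, restrict_withDensity (q.meas i),
        integrable_withDensity_iff_integrable_smul' hfm' (by simp)] at hNi
      simp only [ENNReal.toReal_ofReal (hf0 _), smul_eq_mul] at hNi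
      exact hNi
    have hFW_eq : (fun x => f x / p * (K * N (x - q.c i) ^ r))
        = fun x => K / p * (f x * N (x - q.c i) ^ r) := by
      funext x; ring
    obtain ⟨hgi, hgZ⟩ := integrable_refDensity hd hr ha hε hk hN (q.c i) (q.S i)
    rw [hkC] at hgZ
    have hZ0 : 0 < (volume (Bcell q N ε i)).toReal + C :=
      add_pos_of_nonneg_of_pos ENNReal.toReal_nonneg hC0
    have hgibbs := neg_integral_mul_log_le (ν := volume.restrict (q.S i))
      (F := fun x => f x / p) (W := fun x => K * N (x - q.c i) ^ r)
      (g := fun x => refDensity r (D * δ) ε k (N (x - q.c i)))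
      (fun x => div_nonneg (hf0 x) hp0.le) hF1 hint (by rw [hFW_eq]; exact hfN.const_mul _)
      hgi (fun x => refDensity_pos hk _)
      (fun x => neg_log_refDensity_le hr ha hε hk (hN.nonneg _)) hZ0 hgZ
    rw [← hhi, hFW_eq, integral_const_mul, heI] at hgibbs
    calc p * h i ≤ p * (K / p * (e i).toReal
          + Real.log ((volume (Bcell q N ε i)).toReal + C)) :=
          mul_le_mul_of_nonneg_left hgibbs hp0.le
      _ = _ := by field_simp; ring
  have hlog : Summable fun i =>
      (μ (q.S i)).toReal * Real.log ((volume (Bcell q N ε i)).toReal + C) := by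
    set V := (volume {x | N x ≤ ε}).toReal
    refine Summable.of_norm_bounded
      (hp.summable.mul_right (max |Real.log C| |Real.log (V + C)|)) fun i => ?_
    have hle : (volume (Bcell q N ε i)).toReal ≤ V := by
      refine ENNReal.toReal_mono (hN.volume_le_lt_top ε).ne ?_
      rw [← volume_setOf_sub_le N (q.c i)]
      exact measure_mono fun x hx => hx.2
    have h0 : 0 ≤ (volume (Bcell q N ε i)).toReal := ENNReal.toReal_nonneg
    rw [norm_mul, Real.norm_of_nonneg ENNReal.toReal_nonneg, Real.norm_eq_abs]
    refine mul_le_mul_of_nonneg_left ?_ ENNReal.toReal_nonneg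
    exact abs_le_max_abs_abs (Real.log_le_log hC0 (by linarith))
      (Real.log_le_log (by linarith) (by linarith))
  calc ∑' i : ℤ, (μ (q.S i)).toReal * h i
      ≤ ∑' i : ℤ, ((μ (q.S i)).toReal * Real.log ((volume (Bcell q N ε i)).toReal + C)
          + K * (e i).toReal) :=
        hsum.tsum_le_tsum hcell (hlog.add (he_sum.summable.mul_left K))
    _ = (∑' i : ℤ, (μ (q.S i)).toReal * Real.log ((volume (Bcell q N ε i)).toReal + C))
          + K * (∑' i, e i).toReal := by
        rw [hlog.tsum_add (he_sum.summable.mul_left K), tsum_mul_left, he_sum.tsum_eq]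
    _ ≤ (∑' i : ℤ, (μ (q.S i)).toReal * Real.log ((volume (Bcell q N ε i)).toReal + C))
          + K * D := by gcongr
    _ = _ := by
        rw [hK]
        field_simp
        ring

end
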